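/- arXiv:1902.01125 — 2 statements merged into one kernel-verified Lean document; each statement's English description precedes it below -/
import Mathlib

section
/- Let ε₁, ε₂ > 0 and 1 ≤ q₁, q₂ < ∞, and let B be a Banach space. Suppose {f_j}_{j∈ℤ} is a collection of B-valued measurable functions on ℝ such that ‖f_j‖_{L^{q₁}(ℝ;B)} ≤ M₁·2^{ε₁ j} and ‖f_j‖_{L^{q₂}(ℝ;B)} ≤ M₂·2^{−ε₂ j} for all j∈ℤ. Then ‖Σ_{j∈ℤ} f_j‖_{L^{q,∞}(ℝ;B)} ≤ C·M₁^θ·M₂^{1−θ}, where θ = ε₂/(ε₁+ε₂), 1/q = θ/q₁ + (1−θ)/q₂, and C is a constant depending only on ε₁, ε₂, q₁, q₂. -/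
open MeasureTheory ENNReal

/-- The sums `∑ⱼ 2^(-δ|j - x|)` over the integers are bounded uniformly in `x`. -/
lemma exists_tsum_two_rpow_neg_abs_sub_le {δ : ℝ} (hδ : 0 < δ) :
    ∃ S : ℝ, 0 < S ∧ ∀ x : ℝ,
      ∑' j : ℤ, ENNReal.ofReal ((2 : ℝ) ^ (-δ * |(j : ℝ) - x|)) ≤ ENNReal.ofReal S := by
  have hr1 : (2 : ℝ) ^ (-δ) < 1 := Real.rpow_lt_one_of_one_lt_of_neg one_lt_two (by linarith)
  have hsum : Summable fun j : ℤ => (2 : ℝ) ^ (-δ * |(j : ℝ)|) := by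
    have hg := summable_geometric_of_lt_one (by positivity) hr1
    have hn : Summable fun n : ℕ => (2 : ℝ) ^ (-δ * (n : ℝ)) := by
      refine hg.congr fun n => ?_
      rw [Real.rpow_mul zero_le_two, Real.rpow_natCast]
    refine Summable.of_nat_of_neg ?_ ?_
    · simpa using hn
    · simpa using hn
  have hpos : 0 < ∑' j : ℤ, (2 : ℝ) ^ (-δ * |(j : ℝ)|) :=
    hsum.tsum_pos (fun _ => by positivity) 0 (by positivity)
  refine ⟨2 ^ δ * ∑' j : ℤ, (2 : ℝ) ^ (-δ * |(j : ℝ)|), by positivity, fun x => ?_⟩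
  rw [← tsum_mul_left, ENNReal.ofReal_tsum_of_nonneg (fun _ => by positivity)
    (hsum.mul_left _), ← (Equiv.subRight ⌊x⌋).tsum_eq
      fun j : ℤ => ENNReal.ofReal ((2 : ℝ) ^ δ * 2 ^ (-δ * |(j : ℝ)|))]
  refine ENNReal.tsum_le_tsum fun j => ENNReal.ofReal_le_ofReal ?_
  rw [← Real.rpow_add two_pos]
  refine Real.rpow_le_rpow_of_exponent_le one_le_two ?_
  have h1 : |(j : ℝ) - ⌊x⌋| ≤ |(j : ℝ) - x| + 1 := by
    have h2 : |x - ⌊x⌋| ≤ 1 := by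
      rw [abs_of_nonneg (by linarith [Int.floor_le x])]
      linarith [Int.lt_floor_add_one x]
    linarith [abs_sub_le (j : ℝ) x ⌊x⌋]
  have h3 : ((Equiv.subRight ⌊x⌋ j : ℤ) : ℝ) = (j : ℝ) - ⌊x⌋ := by simp
  rw [h3]
  nlinarith

/-- Chebyshev's inequality from a bound on the `L^p` norm. -/
lemma measure_le_enorm_le_of_lintegral_rpow_le {α B : Type*} [MeasurableSpace α]
    {μ : Measure α} [NormedAddCommGroup B] {g : α → B} (hg : AEStronglyMeasurable g μ)
    {p a K : ℝ} (hp : 0 < p) (ha : 0 < a) (hK : 0 ≤ K)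
    (h : (∫⁻ t, (‖g t‖₊ : ℝ≥0∞) ^ p ∂μ) ^ (1 / p) ≤ ENNReal.ofReal K) :
    μ {t | ENNReal.ofReal a ≤ ‖g t‖ₑ} ≤ ENNReal.ofReal ((K / a) ^ p) := by
  have hint : ∫⁻ t, ‖g t‖ₑ ^ p ∂μ ≤ ENNReal.ofReal (K ^ p) := by
    rw [one_div, ENNReal.rpow_inv_le_iff hp, ENNReal.ofReal_rpow_of_nonneg hK hp.le] at h
    exact h
  have hsub : {t | ENNReal.ofReal a ≤ ‖g t‖ₑ} ⊆ {t | ENNReal.ofReal (a ^ p) ≤ ‖g t‖ₑ ^ p} := by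
    intro t ht
    rw [Set.mem_ofPred_eq, ← ENNReal.ofReal_rpow_of_pos ha]
    exact ENNReal.rpow_le_rpow ht hp.le
  have hap : 0 < a ^ p := Real.rpow_pos_of_pos ha p
  calc μ {t | ENNReal.ofReal a ≤ ‖g t‖ₑ}
      ≤ μ {t | ENNReal.ofReal (a ^ p) ≤ ‖g t‖ₑ ^ p} := measure_mono hsub
    _ ≤ (∫⁻ t, ‖g t‖ₑ ^ p ∂μ) / ENNReal.ofReal (a ^ p) :=
        meas_ge_le_lintegral_div (hg.enorm.pow_const p) (by simpa using hap) ENNReal.ofReal_ne_top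
    _ ≤ ENNReal.ofReal (K ^ p) / ENNReal.ofReal (a ^ p) := by gcongr
    _ = ENNReal.ofReal ((K / a) ^ p) := by
        rw [← ENNReal.ofReal_div_of_pos hap, Real.div_rpow hK ha.le]

/-- If the norm of a sum exceeds `l ≥ ∑ⱼ wⱼ`, then some term has norm at least `wⱼ`. -/
lemma setOf_lt_norm_tsum_subset_iUnion {α ι B : Type*} [NormedAddCommGroup B]
    (f : ι → α → B) {w : ι → ℝ≥0∞} {l : ℝ} (hl : 0 < l)
    (hw : ∑' j, w j ≤ ENNReal.ofReal l) :
    {t | l < ‖∑' j, f j t‖} ⊆ ⋃ j, {t | w j ≤ ‖f j t‖ₑ} := by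
  intro t ht
  by_contra hcon
  simp only [Set.mem_iUnion, Set.mem_ofPred_eq, not_exists, not_le] at hcon ht
  have h1 : ‖∑' j, f j t‖ₑ ≤ ENNReal.ofReal l :=
    (enorm_tsum_le_tsum_enorm).trans ((ENNReal.tsum_le_tsum fun j => (hcon j).le).trans hw)
  rw [← ofReal_norm] at h1
  exact absurd h1 (not_le.mpr ((ENNReal.ofReal_lt_ofReal_iff (hl.trans ht)).mpr ht))

/-- An exponent `x` at which the two Chebyshev bounds agree, and their common value there. -/
lemma exists_balancing_exponent {ε₁ ε₂ q₁ q₂ m₁ m₂ l θ : ℝ} (hε₁ : 0 < ε₁) (hε₂ : 0 < ε₂)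
    (hq₁ : 0 < q₁) (hq₂ : 0 < q₂) (hm₁ : 0 < m₁) (hm₂ : 0 < m₂) (hl : 0 < l)
    (hθ : θ = ε₂ / (ε₁ + ε₂)) :
    ∃ x V : ℝ, 0 < V ∧ (m₁ * 2 ^ (ε₁ * x) / l) ^ q₁ = V ∧ (m₂ * 2 ^ (-ε₂ * x) / l) ^ q₂ = V ∧
      l * V ^ (θ / q₁ + (1 - θ) / q₂) = m₁ ^ θ * m₂ ^ (1 - θ) := by
  have h2 : 0 < Real.log 2 := Real.log_pos one_lt_two
  have hA : ∀ x, 0 < m₁ * 2 ^ (ε₁ * x) / l := fun x => by positivity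
  have hB : ∀ x, 0 < m₂ * 2 ^ (-ε₂ * x) / l := fun x => by positivity
  have hlA : ∀ x, Real.log (m₁ * 2 ^ (ε₁ * x) / l)
      = Real.log m₁ + ε₁ * x * Real.log 2 - Real.log l := fun x => by
    rw [Real.log_div (by positivity) hl.ne', Real.log_mul hm₁.ne' (by positivity),
      Real.log_rpow two_pos]
  have hlB : ∀ x, Real.log (m₂ * 2 ^ (-ε₂ * x) / l)
      = Real.log m₂ + -ε₂ * x * Real.log 2 - Real.log l := fun x => by
    rw [Real.log_div (by positivity) hl.ne', Real.log_mul hm₂.ne' (by positivity),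
      Real.log_rpow two_pos]
  obtain ⟨x, hx⟩ : ∃ x : ℝ, q₁ * (Real.log m₁ + ε₁ * x * Real.log 2 - Real.log l)
      = q₂ * (Real.log m₂ + -ε₂ * x * Real.log 2 - Real.log l) := by
    refine ⟨(q₂ * (Real.log m₂ - Real.log l) - q₁ * (Real.log m₁ - Real.log l))
      / ((ε₁ * q₁ + ε₂ * q₂) * Real.log 2), ?_⟩
    have : ε₁ * q₁ + ε₂ * q₂ ≠ 0 := by positivity
    field_simp
    ring
  have hV : 0 < (m₁ * 2 ^ (ε₁ * x) / l) ^ q₁ := Real.rpow_pos_of_pos (hA x) _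
  refine ⟨x, _, hV, rfl, ?_, ?_⟩
  · refine Real.log_injOn_pos (Real.rpow_pos_of_pos (hB x) _) hV ?_
    rw [Real.log_rpow (hA x), Real.log_rpow (hB x), hlA, hlB, hx]
  · refine Real.log_injOn_pos (mul_pos hl (Real.rpow_pos_of_pos hV _))
      (Set.mem_Ioi.mpr (by positivity)) ?_
    rw [Real.log_mul hl.ne' (Real.rpow_pos_of_pos hV _).ne', Real.log_rpow hV,
      Real.log_mul (by positivity) (by positivity), Real.log_rpow hm₁, Real.log_rpow hm₂,
      Real.log_rpow (hA x), hlA, add_mul]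
    have e1 : θ / q₁ * (q₁ * (Real.log m₁ + ε₁ * x * Real.log 2 - Real.log l))
        = θ * (Real.log m₁ + ε₁ * x * Real.log 2 - Real.log l) := by field_simp
    have e2 : (1 - θ) / q₂ * (q₁ * (Real.log m₁ + ε₁ * x * Real.log 2 - Real.log l))
        = (1 - θ) * (Real.log m₂ + -ε₂ * x * Real.log 2 - Real.log l) := by
      rw [hx]; field_simp
    have e3 : θ * ε₁ = (1 - θ) * ε₂ := by
      have : ε₁ + ε₂ ≠ 0 := by positivity
      rw [hθ]; field_simp; ring
    rw [e1, e2]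
    linear_combination x * Real.log 2 * e3

/-- Decay of the Chebyshev bound away from the balancing level. -/
lemma mul_two_rpow_div_rpow_le {A l S ε δ p t : ℝ} (hA : 0 < A) (hl : 0 < l) (hS : 0 < S)
    (hδ : 0 < δ) (hεδ : 2 * δ ≤ ε) (hp : 1 ≤ p) (ht : 0 ≤ t) :
    (A * l * 2 ^ (-ε * t) / (l / S * 2 ^ (-δ * t))) ^ p ≤ A ^ p * S ^ p * 2 ^ (-δ * t) := by
  have h1 : A * l * 2 ^ (-ε * t) / (l / S * 2 ^ (-δ * t)) = A * S * 2 ^ (-ε * t - -δ * t) := by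
    rw [Real.rpow_sub two_pos]
    field_simp
  rw [h1, Real.mul_rpow (by positivity) (by positivity), Real.mul_rpow hA.le hS.le,
    ← Real.rpow_mul zero_le_two]
  refine mul_le_mul_of_nonneg_left ?_ (by positivity)
  refine Real.rpow_le_rpow_of_exponent_le one_le_two ?_
  have h2 : -ε * t - -δ * t ≤ -δ * t := by nlinarith
  have h3 : -δ * t ≤ 0 := by nlinarith
  nlinarith

/-- The weak-type estimate for finite positive norm bounds. -/
lemma measure_lt_norm_tsum_le {B : Type*} [NormedAddCommGroup B] {α : Type*}
    [MeasurableSpace α] {μ : Measure α} {f : ℤ → α → B}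
    {ε₁ ε₂ q₁ q₂ m₁ m₂ δ S l x V : ℝ} (hq₁ : 1 ≤ q₁) (hq₂ : 1 ≤ q₂)
    (hm₁ : 0 < m₁) (hm₂ : 0 < m₂) (hl : 0 < l) (hS : 0 < S)
    (hδ : 0 < δ) (hδ₁ : 2 * δ ≤ ε₁) (hδ₂ : 2 * δ ≤ ε₂)
    (hSx : ∑' j : ℤ, ENNReal.ofReal ((2 : ℝ) ^ (-δ * |(j : ℝ) - x|)) ≤ ENNReal.ofReal S)
    (hV₁ : (m₁ * 2 ^ (ε₁ * x) / l) ^ q₁ = V) (hV₂ : (m₂ * 2 ^ (-ε₂ * x) / l) ^ q₂ = V)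
    (hf : ∀ j, AEStronglyMeasurable (f j) μ)
    (h₁ : ∀ j : ℤ, (∫⁻ t, (‖f j t‖₊ : ℝ≥0∞) ^ q₁ ∂μ) ^ (1 / q₁)
      ≤ ENNReal.ofReal (m₁ * 2 ^ (ε₁ * (j : ℝ))))
    (h₂ : ∀ j : ℤ, (∫⁻ t, (‖f j t‖₊ : ℝ≥0∞) ^ q₂ ∂μ) ^ (1 / q₂)
      ≤ ENNReal.ofReal (m₂ * 2 ^ (-ε₂ * (j : ℝ)))) :
    μ {t | l < ‖∑' j, f j t‖} ≤ ENNReal.ofReal (V * ((S ^ q₁ + S ^ q₂) * S)) := by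
  have hV : 0 < V := by rw [← hV₁]; positivity
  have hterm : ∀ j : ℤ, μ {t | ENNReal.ofReal (l / S * 2 ^ (-δ * |(j : ℝ) - x|)) ≤ ‖f j t‖ₑ}
      ≤ ENNReal.ofReal (V * (S ^ q₁ + S ^ q₂))
        * ENNReal.ofReal ((2 : ℝ) ^ (-δ * |(j : ℝ) - x|)) := by
    intro j
    rw [← ENNReal.ofReal_mul (by positivity)]
    have ha : 0 < l / S * 2 ^ (-δ * |(j : ℝ) - x|) := by positivity
    rcases le_total (j : ℝ) x with hj | hj
    · refine (measure_le_enorm_le_of_lintegral_rpow_le (hf j) (by linarith) ha (by positivity)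
        (h₁ j)).trans (ENNReal.ofReal_le_ofReal ?_)
      have e : m₁ * 2 ^ (ε₁ * (j : ℝ))
          = m₁ * 2 ^ (ε₁ * x) / l * l * 2 ^ (-ε₁ * |(j : ℝ) - x|) := by
        rw [abs_of_nonpos (by linarith), div_mul_cancel₀ _ hl.ne', mul_assoc,
          ← Real.rpow_add two_pos]
        congr 2; ring
      rw [e]
      refine (mul_two_rpow_div_rpow_le (by positivity) hl hS hδ hδ₁ hq₁ (abs_nonneg _)).trans ?_
      rw [hV₁]
      gcongr
      exact le_add_of_nonneg_right (by positivity)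
    · refine (measure_le_enorm_le_of_lintegral_rpow_le (hf j) (by linarith) ha (by positivity)
        (h₂ j)).trans (ENNReal.ofReal_le_ofReal ?_)
      have e : m₂ * 2 ^ (-ε₂ * (j : ℝ))
          = m₂ * 2 ^ (-ε₂ * x) / l * l * 2 ^ (-ε₂ * |(j : ℝ) - x|) := by
        rw [abs_of_nonneg (by linarith), div_mul_cancel₀ _ hl.ne', mul_assoc,
          ← Real.rpow_add two_pos]
        congr 2; ring
      rw [e]
      refine (mul_two_rpow_div_rpow_le (by positivity) hl hS hδ hδ₂ hq₂ (abs_nonneg _)).trans ?_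
      rw [hV₂]
      gcongr
      exact le_add_of_nonneg_left (by positivity)
  have hw : ∑' j : ℤ, ENNReal.ofReal (l / S * 2 ^ (-δ * |(j : ℝ) - x|)) ≤ ENNReal.ofReal l := by
    calc ∑' j : ℤ, ENNReal.ofReal (l / S * 2 ^ (-δ * |(j : ℝ) - x|))
        = ENNReal.ofReal (l / S) * ∑' j : ℤ, ENNReal.ofReal ((2 : ℝ) ^ (-δ * |(j : ℝ) - x|)) := by
          rw [← ENNReal.tsum_mul_left]
          exact tsum_congr fun j => ENNReal.ofReal_mul (by positivity)
      _ ≤ ENNReal.ofReal (l / S) * ENNReal.ofReal S := by gcongr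
      _ = ENNReal.ofReal l := by
          rw [← ENNReal.ofReal_mul (by positivity), div_mul_cancel₀ _ hS.ne']
  calc μ {t | l < ‖∑' j, f j t‖}
      ≤ ∑' j : ℤ, μ {t | ENNReal.ofReal (l / S * 2 ^ (-δ * |(j : ℝ) - x|)) ≤ ‖f j t‖ₑ} :=
        (measure_mono (setOf_lt_norm_tsum_subset_iUnion f hl hw)).trans (measure_iUnion_le _)
    _ ≤ ENNReal.ofReal (V * (S ^ q₁ + S ^ q₂))
        * ∑' j : ℤ, ENNReal.ofReal ((2 : ℝ) ^ (-δ * |(j : ℝ) - x|)) := by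
        rw [← ENNReal.tsum_mul_left]
        exact ENNReal.tsum_le_tsum hterm
    _ ≤ ENNReal.ofReal (V * (S ^ q₁ + S ^ q₂)) * ENNReal.ofReal S := by gcongr
    _ = ENNReal.ofReal (V * ((S ^ q₁ + S ^ q₂) * S)) := by
        rw [← ENNReal.ofReal_mul (by positivity), mul_assoc]

/-- If all terms have vanishing `L^p` norm, the superlevel sets of the sum are null. -/
lemma measure_lt_norm_tsum_eq_zero {B : Type*} [NormedAddCommGroup B] {α ι : Type*}
    [Countable ι] [MeasurableSpace α] {μ : Measure α} {f : ι → α → B} {p l : ℝ} (hp : 0 < p)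
    (hl : 0 < l) (hf : ∀ j, AEStronglyMeasurable (f j) μ)
    (h : ∀ j, (∫⁻ t, (‖f j t‖₊ : ℝ≥0∞) ^ p ∂μ) ^ (1 / p) ≤ 0) :
    μ {t | l < ‖∑' j, f j t‖} = 0 := by
  have hz : ∀ᵐ t ∂μ, ∀ j, f j t = 0 := by
    refine ae_all_iff.mpr fun j => ?_
    have hj : ∫⁻ t, ‖f j t‖ₑ ^ p ∂μ = 0 := by
      have := nonpos_iff_eq_zero.mp (h j)
      rwa [ENNReal.rpow_eq_zero_iff_of_pos (by positivity)] at this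
    rw [lintegral_eq_zero_iff' ((hf j).enorm.pow_const p)] at hj
    filter_upwards [hj] with t ht
    simpa [ENNReal.rpow_eq_zero_iff_of_pos hp] using ht
  refine measure_mono_null ?_ (ae_iff.mp hz)
  intro t ht h0
  simp only [Set.mem_ofPred_eq, h0, tsum_zero, norm_zero] at ht
  exact absurd hl (not_lt.mpr ht.le)

/-- **Bourgain's summation lemma** (Lemma 2.2 in the paper).
Let `ε₁, ε₂ > 0` and `1 ≤ q₁, q₂ < ∞`, and let `B` be a Banach space. Suppose
`{f_j}_{j ∈ ℤ}` is a collection of `B`-valued measurable functions on `ℝ` with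
`‖f_j‖_{L^{q₁}(ℝ;B)} ≤ M₁ 2^{ε₁ j}` and `‖f_j‖_{L^{q₂}(ℝ;B)} ≤ M₂ 2^{-ε₂ j}` for all `j`.
Then `‖Σ_j f_j‖_{L^{q,∞}(ℝ;B)} ≤ C M₁^θ M₂^{1-θ}` where `θ = ε₂/(ε₁+ε₂)`,
`1/q = θ/q₁ + (1-θ)/q₂`, and `C` depends only on `ε₁, ε₂, q₁, q₂`. -/
theorem bourgain_summation_trick
    (ε₁ ε₂ q₁ q₂ : ℝ) (hε₁ : 0 < ε₁) (hε₂ : 0 < ε₂)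
    (hq₁ : 1 ≤ q₁) (hq₂ : 1 ≤ q₂) :
    ∃ C : ℝ, 0 < C ∧
      ∀ (B : Type*) [NormedAddCommGroup B] [NormedSpace ℝ B] [CompleteSpace B]
        (f : ℤ → ℝ → B) (M₁ M₂ : ℝ≥0∞),
        (∀ j : ℤ, AEStronglyMeasurable (f j) volume) →
        (∀ j : ℤ, (∫⁻ t : ℝ, (‖f j t‖₊ : ℝ≥0∞) ^ q₁) ^ (1 / q₁)
            ≤ M₁ * (2 : ℝ≥0∞) ^ (ε₁ * (j : ℝ))) →
        (∀ j : ℤ, (∫⁻ t : ℝ, (‖f j t‖₊ : ℝ≥0∞) ^ q₂) ^ (1 / q₂)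
            ≤ M₂ * (2 : ℝ≥0∞) ^ (-ε₂ * (j : ℝ))) →
        ∀ θ q : ℝ, θ = ε₂ / (ε₁ + ε₂) → 1 / q = θ / q₁ + (1 - θ) / q₂ →
        (⨆ (l : ℝ) (_ : 0 < l),
            ENNReal.ofReal l * (volume {t : ℝ | l < ‖∑' j : ℤ, f j t‖}) ^ (1 / q))
          ≤ ENNReal.ofReal C * M₁ ^ θ * M₂ ^ (1 - θ) := by
  set r : ℝ := ε₂ / (ε₁ + ε₂) / q₁ + (1 - ε₂ / (ε₁ + ε₂)) / q₂ with hr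
  have hδ : 0 < min ε₁ ε₂ / 2 := by positivity
  obtain ⟨S, hS, hSx⟩ := exists_tsum_two_rpow_neg_abs_sub_le hδ
  refine ⟨((S ^ q₁ + S ^ q₂) * S) ^ r, by positivity, ?_⟩
  intro B _ _ _ f M₁ M₂ hf h₁ h₂ θ q hθ hq
  have hθ0 : 0 < θ := by rw [hθ]; positivity
  have hθ1 : 0 < 1 - θ := by
    rw [hθ, sub_pos, div_lt_one (by positivity)]
    linarith
  have hr0 : 0 < r := by
    rw [hr, ← hθ]
    positivity
  rw [← hθ] at hr
  rw [hq, ← hr]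
  refine iSup₂_le fun l hl => ?_
  rcases eq_or_ne M₁ 0 with rfl | hM₁
  · rw [measure_lt_norm_tsum_eq_zero (by linarith : 0 < q₁) hl hf (by simpa using h₁),
      ENNReal.zero_rpow_of_pos hr0, mul_zero]
    exact zero_le
  rcases eq_or_ne M₂ 0 with rfl | hM₂
  · rw [measure_lt_norm_tsum_eq_zero (by linarith : 0 < q₂) hl hf (by simpa using h₂),
      ENNReal.zero_rpow_of_pos hr0, mul_zero]
    exact zero_le
  have hC : ENNReal.ofReal (((S ^ q₁ + S ^ q₂) * S) ^ r) ≠ 0 := by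
    rw [← pos_iff_ne_zero, ENNReal.ofReal_pos]
    positivity
  have hM₁θ : M₁ ^ θ ≠ 0 := by simp [ENNReal.rpow_eq_zero_iff_of_pos hθ0, hM₁]
  have hM₂θ : M₂ ^ (1 - θ) ≠ 0 := by simp [ENNReal.rpow_eq_zero_iff_of_pos hθ1, hM₂]
  rcases eq_or_ne M₁ ∞ with rfl | hM₁'
  · rw [ENNReal.top_rpow_of_pos hθ0, ENNReal.mul_top hC, ENNReal.top_mul hM₂θ]
    exact le_top
  rcases eq_or_ne M₂ ∞ with rfl | hM₂'
  · rw [ENNReal.top_rpow_of_pos hθ1, ENNReal.mul_top (mul_ne_zero hC hM₁θ)]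
    exact le_top
  obtain ⟨m₁, hm₁, rfl⟩ : ∃ m : ℝ, 0 < m ∧ ENNReal.ofReal m = M₁ :=
    ⟨M₁.toReal, ENNReal.toReal_pos hM₁ hM₁', ENNReal.ofReal_toReal hM₁'⟩
  obtain ⟨m₂, hm₂, rfl⟩ : ∃ m : ℝ, 0 < m ∧ ENNReal.ofReal m = M₂ :=
    ⟨M₂.toReal, ENNReal.toReal_pos hM₂ hM₂', ENNReal.ofReal_toReal hM₂'⟩
  have htwo : ∀ (m y : ℝ), 0 < m →
      ENNReal.ofReal m * (2 : ℝ≥0∞) ^ y = ENNReal.ofReal (m * 2 ^ y) := fun m y hm => by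
    rw [ENNReal.ofReal_mul hm.le, ← ENNReal.ofReal_rpow_of_pos two_pos, ENNReal.ofReal_ofNat]
  simp only [htwo _ _ hm₁] at h₁
  simp only [htwo _ _ hm₂] at h₂
  obtain ⟨x, V, hV, hV₁, hV₂, hlV⟩ := exists_balancing_exponent hε₁ hε₂
    (by linarith : 0 < q₁) (by linarith : 0 < q₂) hm₁ hm₂ hl hθ
  have hmeas := measure_lt_norm_tsum_le hq₁ hq₂ hm₁ hm₂ hl hS hδ
    (by linarith [min_le_left ε₁ ε₂]) (by linarith [min_le_right ε₁ ε₂]) (hSx x) hV₁ hV₂ hf h₁ h₂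
  calc ENNReal.ofReal l * volume {t : ℝ | l < ‖∑' j : ℤ, f j t‖} ^ r
      ≤ ENNReal.ofReal l * ENNReal.ofReal (V * ((S ^ q₁ + S ^ q₂) * S)) ^ r := by gcongr
    _ = ENNReal.ofReal (((S ^ q₁ + S ^ q₂) * S) ^ r * (m₁ ^ θ * m₂ ^ (1 - θ))) := by
        rw [ENNReal.ofReal_rpow_of_pos (by positivity), ← ENNReal.ofReal_mul hl.le,
          Real.mul_rpow hV.le (by positivity), ← hlV, ← hr]
        congr 1
        ring
    _ = ENNReal.ofReal (((S ^ q₁ + S ^ q₂) * S) ^ r) * ENNReal.ofReal m₁ ^ θ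
        * ENNReal.ofReal m₂ ^ (1 - θ) := by
        rw [ENNReal.ofReal_mul (by positivity), ENNReal.ofReal_mul (by positivity),
          ENNReal.ofReal_rpow_of_pos hm₁, ENNReal.ofReal_rpow_of_pos hm₂, mul_assoc]
end

section
/- Let d≥2 and set ρ = (d+1)/4. Then for all t≠0 and all Schwartz functions f on ℝ^d, the half-wave propagator satisfies the Besov-space dispersive estimate ‖e^{it√(−Δ)}f‖_{Ḃ^{−ρ}_{∞,2}} ≤ C|t|^{−(d−1)/2}‖f‖_{Ḃ^ρ_{1,2}}, with C independent of t and f. -/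
open MeasureTheory ENNReal
open scoped FourierTransform SchwartzMap

/-- The half-wave propagator `e^{it√(−Δ)} f = 𝓕⁻¹(ξ ↦ e^{it|ξ|} (𝓕 f)(ξ))` on `ℝ^d`. -/
noncomputable def halfWave (d : ℕ) (t : ℝ) (f : EuclideanSpace ℝ (Fin d) → ℂ) :
    EuclideanSpace ℝ (Fin d) → ℂ :=
  𝓕⁻ (fun ξ => Complex.exp (Complex.I * t * ‖ξ‖) * 𝓕 f ξ)

/-- Convolution `(g * h)(x) = ∫ g(y) h(x − y) dy` of ℂ-valued functions on `ℝ^d`. -/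
noncomputable def conv (d : ℕ) (g h : EuclideanSpace ℝ (Fin d) → ℂ) :
    EuclideanSpace ℝ (Fin d) → ℂ :=
  fun x => ∫ y, g y * h (x - y)

/-- The Littlewood–Paley piece `φ_j = 𝓕⁻¹(ψ(2^{−j}·))` associated to the bump `ψ = φ̂`. -/
noncomputable def lpPiece (d : ℕ) (ψ : EuclideanSpace ℝ (Fin d) → ℂ) (j : ℤ) :
    EuclideanSpace ℝ (Fin d) → ℂ :=
  𝓕⁻ (fun ξ => ψ ((2 : ℝ) ^ (-j) • ξ))

/-- The homogeneous Besov norm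
`‖g‖_{Ḃ^ρ_{r,2}} = (Σ_{j∈ℤ} (2^{ρ j} ‖g * φ_j‖_{L^r})²)^{1/2}`,
computed with the Littlewood–Paley pieces built from `ψ = φ̂`. -/
noncomputable def besovNorm (d : ℕ) (ψ : EuclideanSpace ℝ (Fin d) → ℂ) (ρ : ℝ) (r : ℝ≥0∞)
    (g : EuclideanSpace ℝ (Fin d) → ℂ) : ℝ≥0∞ :=
  (∑' j : ℤ, ((2 : ℝ≥0∞) ^ (ρ * (j : ℝ)) *
      eLpNorm (conv d g (lpPiece d ψ j)) r volume) ^ (2 : ℝ)) ^ (1 / (2 : ℝ))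


open Set in
/-- **Cauchy–Schlömilch substitution** for complex Gaussians. -/
theorem integral_Ioi_cexp_neg_mul_sub_div_sq {s : ℂ} (hs : 0 < s.re) {c : ℝ} (hc : 0 ≤ c) :
    ∫ y in Ioi (0 : ℝ), Complex.exp (-s * ((y - c / y : ℝ) : ℂ) ^ 2) =
      ((Real.pi : ℂ) / s) ^ (1 / 2 : ℂ) / 2 := by
  rcases hc.eq_or_lt with rfl | hc
  · simpa using integral_gaussian_complex_Ioi hs
  set E : ℝ → ℂ := fun w => Complex.exp (-s * (w : ℂ) ^ 2) with hE
  set R : ℝ → ℝ := fun w => √(w ^ 2 + 4 * c) with hR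
  have hpos (w : ℝ) : 0 < w ^ 2 + 4 * c := by positivity
  have hRpos (w : ℝ) : 0 < R w := Real.sqrt_pos.2 (hpos w)
  have hRsq (w : ℝ) : R w ^ 2 = w ^ 2 + 4 * c := Real.sq_sqrt (hpos w).le
  have hlt (w : ℝ) : |w| < R w := by
    rw [← abs_of_pos (hRpos w), ← sq_lt_sq, hRsq]
    linarith
  set F : ℝ → ℝ := fun w => (w + R w) / 2 with hF
  have hFpos (w : ℝ) : 0 < F w := by
    have := neg_abs_le w
    have := hlt w
    simp only [hF]
    linarith
  have hinv (w : ℝ) : F w - c / F w = w := by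
    have h := (hFpos w).ne'
    field_simp
    simp only [hF]
    nlinarith [hRsq w]
  have hRderiv (w : ℝ) : HasDerivAt R (w / R w) w := by
    have h := ((hasDerivAt_pow 2 w).add_const (4 * c)).sqrt (hpos w).ne'
    convert h using 1
    simp only [hR]
    field_simp
    simp [mul_comm]
  have hderiv (w : ℝ) : HasDerivAt F ((1 + w / R w) / 2) w :=
    ((hasDerivAt_id w).add (hRderiv w)).div_const 2
  have hk (w : ℝ) : |w / R w| ≤ 1 := by
    rw [abs_div, abs_of_pos (hRpos w), div_le_one (hRpos w)]
    exact (hlt w).le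
  have himage : F '' univ = Ioi 0 := by
    ext y
    simp only [image_univ, mem_range, mem_Ioi]
    refine ⟨?_, fun hy => ⟨y - c / y, ?_⟩⟩
    · rintro ⟨w, rfl⟩
      exact hFpos w
    · have : R (y - c / y) = y + c / y := by
        simp only [hR]
        rw [Real.sqrt_eq_iff_mul_self_eq (hpos _).le (by positivity)]
        field_simp
        ring
      simp only [hF, this]
      ring
  have hinj : InjOn F univ := fun a _ b _ hab => by
    rw [← hinv a, ← hinv b, hab]
  have hEint : Integrable E := integrable_cexp_neg_mul_sq hs
  have hRcont : Continuous R := by fun_prop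
  have hkEint : Integrable (fun w => ((w / R w : ℝ) : ℂ) * E w) := by
    refine hEint.bdd_mul (c := 1) ?_ (.of_forall fun w => ?_)
    · refine Continuous.aestronglyMeasurable ?_
      exact Complex.continuous_ofReal.comp
        (continuous_id.div hRcont fun w => (hRpos w).ne')
    · rw [Complex.norm_real]
      exact hk w
  have hodd : ∫ w, ((w / R w : ℝ) : ℂ) * E w = 0 := by
    have h := integral_neg_eq_self (fun w => ((w / R w : ℝ) : ℂ) * E w) volume
    have h' : (fun w => ((-w / R (-w) : ℝ) : ℂ) * E (-w)) =
        fun w => -(((w / R w : ℝ) : ℂ) * E w) := by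
      funext w
      simp [hR, hE, neg_div]
    rw [h', integral_neg] at h
    exact self_eq_neg.1 h.symm
  rw [← himage, integral_image_eq_integral_abs_deriv_smul MeasurableSet.univ
    (fun w _ => (hderiv w).hasDerivWithinAt) hinj, setIntegral_univ]
  have hpt (w : ℝ) : |(1 + w / R w) / 2| • Complex.exp (-s * ((F w - c / F w : ℝ) : ℂ) ^ 2) =
      (1 / 2 : ℂ) * (E w + ((w / R w : ℝ) : ℂ) * E w) := by
    rw [hinv, abs_of_nonneg (by linarith [(abs_le.1 (hk w)).1]), Complex.real_smul]
    simp only [hE]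
    push_cast
    ring
  simp_rw [hpt]
  rw [integral_const_mul, integral_add hEint hkEint, hodd, integral_gaussian_complex hs]
  ring

open Set in
/-- **Gaussian subordination** of the exponential, with complex parameter. -/
theorem integral_Ioi_cexp_subordination {s : ℂ} (hs : 0 < s.re) {r : ℝ} (hr : 0 ≤ r) :
    ∫ y in Ioi (0 : ℝ), Complex.exp (-s * (y : ℂ) ^ 2) *
        Complex.exp (-(s / (4 * (y : ℂ) ^ 2)) * (r : ℂ) ^ 2) =
      ((Real.pi : ℂ) / s) ^ (1 / 2 : ℂ) / 2 * Complex.exp (-s * r) := by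
  rw [← integral_Ioi_cexp_neg_mul_sub_div_sq hs (c := r / 2) (by positivity),
    ← integral_mul_const]
  refine setIntegral_congr_fun measurableSet_Ioi fun y hy => ?_
  have hy' : (y : ℂ) ≠ 0 := Complex.ofReal_ne_zero.2 (ne_of_gt hy)
  simp only [← Complex.exp_add]
  congr 1
  push_cast
  field_simp
  ring

section Kernel

variable {V : Type*} [NormedAddCommGroup V] [InnerProductSpace ℝ V] [FiniteDimensional ℝ V]
  [MeasurableSpace V] [BorelSpace V]

open Set

theorem integrable_prod_subordination {s : ℂ} (hs : 0 < s.re) :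
    Integrable (fun p : V × ℝ => Complex.exp (-s * (p.2 : ℂ) ^ 2) *
        Complex.exp (-(s / (4 * (p.2 : ℂ) ^ 2)) * (‖p.1‖ : ℂ) ^ 2))
      ((volume : Measure V).prod (volume.restrict (Ioi (0 : ℝ)))) := by
  have hre (y : ℝ) : (s / (4 * (y : ℂ) ^ 2)).re = s.re / (4 * y ^ 2) := by
    have : (4 * (y : ℂ) ^ 2) = ((4 * y ^ 2 : ℝ) : ℂ) := by push_cast; rfl
    rw [this, Complex.div_ofReal_re]
  have hmeas : Measurable (fun p : V × ℝ => Complex.exp (-s * (p.2 : ℂ) ^ 2) *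
      Complex.exp (-(s / (4 * (p.2 : ℂ) ^ 2)) * (‖p.1‖ : ℂ) ^ 2)) := by
    fun_prop
  rw [integrable_prod_iff' hmeas.aestronglyMeasurable]
  constructor
  · filter_upwards [self_mem_ae_restrict measurableSet_Ioi] with y hy
    have hy : 0 < y := hy
    refine Integrable.const_mul ?_ _
    have hb : 0 < (s / (4 * (y : ℂ) ^ 2)).re := by rw [hre]; positivity
    simpa using GaussianFourier.integrable_cexp_neg_mul_sq_norm_add (V := V) hb 0 0
  · have hint : IntegrableOn (fun y : ℝ => (4 * Real.pi / s.re) ^ (Module.finrank ℝ V / 2 : ℝ) *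
        (y ^ (Module.finrank ℝ V : ℝ) * Real.exp (-s.re * y ^ 2))) (Ioi 0) :=
      (integrableOn_rpow_mul_exp_neg_mul_sq hs
        (lt_of_lt_of_le (by norm_num) (Nat.cast_nonneg _))).const_mul _
    refine hint.congr_fun (fun y hy => ?_) measurableSet_Ioi
    have hy : 0 < y := hy
    have hb : 0 < s.re / (4 * y ^ 2) := by positivity
    have hn (v : V) : ‖Complex.exp (-s * (y : ℂ) ^ 2) *
        Complex.exp (-(s / (4 * (y : ℂ) ^ 2)) * (‖v‖ : ℂ) ^ 2)‖ =
        Real.exp (-s.re * y ^ 2) * Real.exp (-(s.re / (4 * y ^ 2)) * ‖v‖ ^ 2) := by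
      rw [norm_mul, Complex.norm_exp, Complex.norm_exp]
      congr 2
      · rw [← Complex.ofReal_pow, Complex.re_mul_ofReal, Complex.neg_re]
      · rw [← Complex.ofReal_pow ‖v‖, Complex.re_mul_ofReal, Complex.neg_re, hre]
    simp only [hn]
    rw [integral_const_mul, GaussianFourier.integral_rexp_neg_mul_sq_norm hb,
      show Real.pi / (s.re / (4 * y ^ 2)) = (4 * Real.pi / s.re) * y ^ 2 by field_simp,
      Real.mul_rpow (by positivity) (by positivity), ← Real.rpow_natCast y 2,
      ← Real.rpow_mul hy.le]
    rw [show ((2 : ℕ) : ℝ) * (Module.finrank ℝ V / 2 : ℝ) = Module.finrank ℝ V by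
      push_cast; ring]
    ring

theorem integrable_cexp_neg_mul_norm {s : ℂ} (hs : 0 < s.re) :
    Integrable (fun v : V => Complex.exp (-s * ‖v‖)) := by
  have h := (integrable_prod_subordination (V := V) hs).integral_prod_left
  simp only [integral_Ioi_cexp_subordination hs (norm_nonneg _)] at h
  have hs0 : s ≠ 0 := by rintro rfl; simp at hs
  refine (integrable_const_mul_iff (IsUnit.mk0 _ ?_) _).1 h
  refine div_ne_zero ((Complex.cpow_ne_zero_iff_of_exponent_ne_zero (by norm_num)).2 ?_)
    two_ne_zero
  exact div_ne_zero (Complex.ofReal_ne_zero.2 Real.pi_ne_zero) hs0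

/-- The complex Poisson kernel decays in the modulus of its parameter. -/
theorem norm_fourierInv_cexp_neg_mul_norm_le {s : ℂ} (hs : 0 < s.re) (w : V) :
    ‖𝓕⁻ (fun v : V => Complex.exp (-s * ‖v‖)) w‖ ≤
      (Real.pi ^ (-(1 / 2) : ℝ) * (4 * Real.pi) ^ (Module.finrank ℝ V / 2 : ℝ) *
        Real.Gamma ((Module.finrank ℝ V + 1) / 2)) *
      (s.re ^ (-((Module.finrank ℝ V + 1) / 2 : ℝ)) *
        ‖s‖ ^ (-((Module.finrank ℝ V - 1) / 2 : ℝ))) := by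
  set n := Module.finrank ℝ V with hn
  have hs0 : s ≠ 0 := by rintro rfl; simp at hs
  have hsn : 0 < ‖s‖ := norm_pos_iff.2 hs0
  set κ : ℂ := ((Real.pi : ℂ) / s) ^ (1 / 2 : ℂ) / 2 with hκ
  have hκn : ‖κ‖ = (Real.pi / ‖s‖) ^ (1 / 2 : ℝ) / 2 := by
    rw [hκ, norm_div, show (1 / 2 : ℂ) = ((1 / 2 : ℝ) : ℂ) by push_cast; rfl,
      Complex.norm_cpow_real, norm_div, Complex.norm_real, Real.norm_of_nonneg Real.pi_pos.le]
    simp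
  have hre (y : ℝ) : (s / (4 * (y : ℂ) ^ 2)).re = s.re / (4 * y ^ 2) := by
    have : (4 * (y : ℂ) ^ 2) = ((4 * y ^ 2 : ℝ) : ℂ) := by push_cast; rfl
    rw [this, Complex.div_ofReal_re]
  -- the subordination formula and Fubini
  have key : κ * 𝓕⁻ (fun v : V => Complex.exp (-s * ‖v‖)) w =
      ∫ y in Ioi (0 : ℝ), Complex.exp (-s * (y : ℂ) ^ 2) *
        𝓕⁻ (fun v : V => Complex.exp (-(s / (4 * (y : ℂ) ^ 2)) * (‖v‖ : ℂ) ^ 2)) w := by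
    simp only [Real.fourierInv_eq', smul_eq_mul]
    rw [← integral_const_mul]
    have h1 (v : V) : κ * (Complex.exp (↑(2 * Real.pi * inner ℝ v w) * Complex.I) *
        Complex.exp (-s * ‖v‖)) = ∫ y in Ioi (0 : ℝ),
          Complex.exp (↑(2 * Real.pi * inner ℝ v w) * Complex.I) *
          (Complex.exp (-s * (y : ℂ) ^ 2) *
            Complex.exp (-(s / (4 * (y : ℂ) ^ 2)) * (‖v‖ : ℂ) ^ 2)) := by
      rw [integral_const_mul, integral_Ioi_cexp_subordination hs (norm_nonneg _)]
      ring
    simp_rw [h1]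
    rw [integral_integral_swap]
    · refine integral_congr_ae (.of_forall fun y => ?_)
      simp only
      rw [← integral_const_mul]
      refine integral_congr_ae (.of_forall fun v => ?_)
      simp only
      ring
    · refine (integrable_prod_subordination (V := V) hs).bdd_mul (c := 1) ?_
        (.of_forall fun p => ?_)
      · exact Continuous.aestronglyMeasurable (by fun_prop)
      · rw [Complex.norm_exp_ofReal_mul_I]
  have hbound : ‖κ * 𝓕⁻ (fun v : V => Complex.exp (-s * ‖v‖)) w‖ ≤
      ∫ y in Ioi (0 : ℝ), (4 * Real.pi / ‖s‖) ^ (n / 2 : ℝ) *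
        (y ^ (n : ℝ) * Real.exp (-s.re * y ^ (2 : ℝ))) := by
    rw [key]
    have hint : IntegrableOn (fun y : ℝ => (4 * Real.pi / ‖s‖) ^ (n / 2 : ℝ) *
        (y ^ (n : ℝ) * Real.exp (-s.re * y ^ (2 : ℝ)))) (Ioi 0) := by
      refine Integrable.const_mul ?_ _
      simp only [Real.rpow_two]
      exact integrableOn_rpow_mul_exp_neg_mul_sq hs
        (lt_of_lt_of_le (by norm_num) (Nat.cast_nonneg _))
    refine norm_integral_le_of_norm_le hint ?_
    filter_upwards [self_mem_ae_restrict measurableSet_Ioi] with y hy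
    have hy : 0 < y := hy
    have hb : 0 < (s / (4 * (y : ℂ) ^ 2)).re := by rw [hre]; positivity
    have hb' : 0 ≤ (1 / (s / (4 * (y : ℂ) ^ 2))).re := by
      rw [one_div, Complex.inv_re]
      exact div_nonneg hb.le (Complex.normSq_nonneg _)
    rw [Real.fourierInv_eq_fourier_neg, fourier_gaussian_innerProductSpace hb, norm_mul, norm_mul,
      Complex.norm_exp, Complex.norm_exp, ← hn,
      show ((n : ℂ) / 2) = ((n / 2 : ℝ) : ℂ) by push_cast; rfl, Complex.norm_cpow_real,
      ← Complex.ofReal_pow, Complex.re_mul_ofReal, Complex.neg_re]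
    have hexp : Real.exp (-(Real.pi : ℂ) ^ 2 * (‖-w‖ : ℂ) ^ 2 / (s / (4 * (y : ℂ) ^ 2))).re ≤ 1 := by
      rw [Real.exp_le_one_iff]
      have : -(Real.pi : ℂ) ^ 2 * (‖-w‖ : ℂ) ^ 2 / (s / (4 * (y : ℂ) ^ 2)) =
          ((-(Real.pi ^ 2 * ‖w‖ ^ 2) : ℝ) : ℂ) * (1 / (s / (4 * (y : ℂ) ^ 2))) := by
        rw [norm_neg]
        push_cast
        ring
      rw [this, Complex.re_ofReal_mul]
      exact mul_nonpos_of_nonpos_of_nonneg (by simpa using by positivity) hb'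
    have hpow : ‖(Real.pi : ℂ) / (s / (4 * ((y ^ 2 : ℝ) : ℂ)))‖ ^ (n / 2 : ℝ) =
        (4 * Real.pi / ‖s‖) ^ (n / 2 : ℝ) * y ^ (n : ℝ) := by
      have : ‖(Real.pi : ℂ) / (s / (4 * ((y ^ 2 : ℝ) : ℂ)))‖ = (4 * Real.pi / ‖s‖) * y ^ 2 := by
        simp only [norm_div, norm_mul, Complex.norm_real, Real.norm_of_nonneg Real.pi_pos.le,
          Real.norm_of_nonneg (sq_nonneg y), Complex.norm_ofNat]
        field_simp
      rw [this, Real.mul_rpow (by positivity) (by positivity), ← Real.rpow_natCast y 2,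
        ← Real.rpow_mul hy.le]
      congr 2
      push_cast
      ring
    rw [Complex.ofReal_pow] at hpow ⊢
    rw [hpow, Real.rpow_two]
    calc _ ≤ Real.exp (-s.re * y ^ 2) * ((4 * Real.pi / ‖s‖) ^ (n / 2 : ℝ) * y ^ (n : ℝ) * 1) := by
          gcongr
      _ = _ := by ring
  rw [integral_const_mul, integral_rpow_mul_exp_neg_mul_rpow two_pos
    (lt_of_lt_of_le (by norm_num) (Nat.cast_nonneg _)) hs, norm_mul, hκn] at hbound
  have hκpos : 0 < (Real.pi / ‖s‖) ^ (1 / 2 : ℝ) / 2 := by positivity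
  refine le_of_mul_le_mul_left (hbound.trans_eq ?_) hκpos
  rw [Real.div_rpow Real.pi_pos.le hsn.le, Real.div_rpow (by positivity) hsn.le,
    Real.rpow_neg Real.pi_pos.le,
    show (-((n - 1) / 2 : ℝ)) = 1 / 2 - n / 2 by ring, Real.rpow_sub hsn,
    show (-((n : ℝ) + 1) / 2) = -((n + 1) / 2 : ℝ) by ring]
  field_simp

end Kernel

/-- A smooth compactly supported function equal to `e^{‖ξ‖}` on the annulus
`1/2 ≤ ‖ξ‖ ≤ 2`. -/
theorem exists_contDiff_eq_cexp_norm_on_annulus {V : Type*} [NormedAddCommGroup V]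
    [InnerProductSpace ℝ V] [FiniteDimensional ℝ V] :
    ∃ m : V → ℂ, ContDiff ℝ (⊤ : ℕ∞) m ∧ HasCompactSupport m ∧
      ∀ ξ, 1 / 2 ≤ ‖ξ‖ → ‖ξ‖ ≤ 2 → m ξ = Complex.exp ‖ξ‖ := by
  let χ₀ : ContDiffBump (0 : V) := ⟨1 / 4, 1 / 2, by norm_num, by norm_num⟩
  let χ₁ : ContDiffBump (0 : V) := ⟨2, 3, by norm_num, by norm_num⟩
  refine ⟨fun ξ => ((Real.exp ‖ξ‖ * (1 - χ₀ ξ) * χ₁ ξ : ℝ) : ℂ), ?_, ?_, ?_⟩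
  · refine Complex.ofRealCLM.contDiff.comp (contDiff_iff_contDiffAt.2 fun ξ => ?_)
    by_cases hξ : ξ = 0
    · subst hξ
      refine contDiffAt_const (c := (0 : ℝ)) |>.congr_of_eventuallyEq ?_
      filter_upwards [χ₀.eventuallyEq_one] with v hv
      change Real.exp ‖v‖ * (1 - χ₀ v) * χ₁ v = 0
      simp [hv]
    · exact ((contDiffAt_norm ℝ hξ).exp.mul (contDiffAt_const.sub χ₀.contDiffAt)).mul
        χ₁.contDiffAt
  · exact (χ₁.hasCompactSupport.mul_left).comp_left (g := fun r : ℝ => (r : ℂ)) (by simp)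
  · intro ξ h1 h2
    have hi : χ₀ ξ = 0 := χ₀.zero_of_le_dist (by simpa [χ₀] using h1)
    have ho : χ₁ ξ = 1 := χ₁.one_of_mem_closedBall (by simpa [χ₁] using h2)
    simp [hi, ho]

theorem exists_schwartz_eq_comp_smul {V : Type*} [NormedAddCommGroup V] [NormedSpace ℝ V]
    {m : V → ℂ} (hm : ContDiff ℝ (⊤ : ℕ∞) m) (hc : HasCompactSupport m) {r : ℝ} (hr : r ≠ 0) :
    ∃ S : 𝓢(V, ℂ), ⇑S = fun ξ => m (r • ξ) :=
  ⟨HasCompactSupport.toSchwartzMap (f := fun ξ => m (r • ξ)) (hc.comp_smul hr)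
    (hm.comp (contDiff_const_smul r)), rfl⟩

section FourierConvolution

variable {V : Type*} [NormedAddCommGroup V] [InnerProductSpace ℝ V] [FiniteDimensional ℝ V]
  [MeasurableSpace V] [BorelSpace V]

/-- A Fourier multiplier with integrable symbol acts by convolution with its kernel. -/
theorem fourierInv_mul_fourier_eq_integral {H M : V → ℂ} (hH : Integrable H) (hM : Integrable M)
    (x : V) :
    𝓕⁻ (fun ξ => H ξ * 𝓕 M ξ) x = ∫ y, M y * 𝓕⁻ H (x - y) := by
  simp only [Real.fourierInv_eq', Real.fourier_eq', smul_eq_mul, ← integral_const_mul]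
  rw [integral_integral_swap]
  · refine integral_congr_ae (.of_forall fun y => ?_)
    refine integral_congr_ae (.of_forall fun ξ => ?_)
    have : Complex.exp (↑(2 * Real.pi * inner ℝ ξ (x - y)) * Complex.I) =
        Complex.exp (↑(2 * Real.pi * inner ℝ ξ x) * Complex.I) *
          Complex.exp (↑(-2 * Real.pi * inner ℝ y ξ) * Complex.I) := by
      rw [← Complex.exp_add, inner_sub_right, real_inner_comm ξ y]
      congr 1
      push_cast
      ring
    simp only [this]
    ring
  · have h := (hH.mul_prod hM).bdd_mul (c := 1) (f := fun p : V × V =>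
      Complex.exp (↑(2 * Real.pi * inner ℝ p.1 x) * Complex.I) *
          Complex.exp (↑(-2 * Real.pi * inner ℝ p.2 p.1) * Complex.I))
      (Continuous.aestronglyMeasurable (by fun_prop)) (.of_forall fun p => by
        rw [norm_mul, Complex.norm_exp_ofReal_mul_I, Complex.norm_exp_ofReal_mul_I, one_mul])
    refine h.congr (.of_forall fun p => ?_)
    simp only [Function.uncurry]
    ring

theorem norm_fourierInv_mul_fourier_le {H M : V → ℂ} (hH : Integrable H) (hM : Integrable M)
    {B : ℝ} (hB : ∀ x, ‖𝓕⁻ H x‖ ≤ B) (x : V) :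
    ‖𝓕⁻ (fun ξ => H ξ * 𝓕 M ξ) x‖ ≤ B * ∫ y, ‖M y‖ := by
  rw [fourierInv_mul_fourier_eq_integral hH hM, ← integral_const_mul]
  refine norm_integral_le_of_norm_le (hM.norm.const_mul B) (.of_forall fun y => ?_)
  rw [norm_mul, mul_comm]
  exact mul_le_mul_of_nonneg_right (hB _) (norm_nonneg _)

theorem fourierInv_comp_smul (m : V → ℂ) {r : ℝ} (hr : 0 < r) (x : V) :
    𝓕⁻ (fun ξ => m (r • ξ)) x =
      ((r ^ Module.finrank ℝ V)⁻¹ : ℝ) • 𝓕⁻ m (r⁻¹ • x) := by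
  simp only [Real.fourierInv_eq']
  rw [← Measure.integral_comp_smul_of_nonneg volume
    (fun v => Complex.exp (↑(2 * Real.pi * inner ℝ v (r⁻¹ • x)) * Complex.I) • m v) r
    (hR := hr.le)]
  simp [inner_smul_left, inner_smul_right, hr.ne']

theorem integral_norm_fourierInv_comp_smul (m : V → ℂ) {r : ℝ} (hr : 0 < r) :
    ∫ x, ‖𝓕⁻ (fun ξ => m (r • ξ)) x‖ = ∫ x, ‖𝓕⁻ m x‖ := by
  simp only [fourierInv_comp_smul m hr, norm_smul]
  rw [integral_const_mul, Measure.integral_comp_smul_of_nonneg volume (fun x => ‖𝓕⁻ m x‖) r⁻¹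
    (hR := (inv_pos.2 hr).le)]
  simp [abs_of_pos hr, hr.ne']

end FourierConvolution

section LittlewoodPaley

variable {d : ℕ} {ψ : EuclideanSpace ℝ (Fin d) → ℂ}

/-- The Littlewood–Paley pieces of the half-wave propagator as Fourier multipliers. -/
theorem conv_halfWave_lpPiece_eq {j : ℤ} {Ψ : 𝓢(EuclideanSpace ℝ (Fin d), ℂ)}
    (hΨ : ⇑Ψ = fun ξ => ψ ((2 : ℝ) ^ (-j) • ξ)) (t : ℝ) (f : 𝓢(EuclideanSpace ℝ (Fin d), ℂ)) :
    conv d (halfWave d t f) (lpPiece d ψ j) =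
      𝓕⁻ (fun ξ => Complex.exp (Complex.I * t * ‖ξ‖) * 𝓕 (⇑f) ξ * Ψ ξ) := by
  have hφ : lpPiece d ψ j = ⇑(𝓕⁻ Ψ : 𝓢(EuclideanSpace ℝ (Fin d), ℂ)) := by
    rw [lpPiece, ← hΨ, SchwartzMap.fourierInv_coe]
  have hF : 𝓕 (lpPiece d ψ j) = ⇑Ψ := by
    rw [hφ, ← SchwartzMap.fourier_coe, FourierTransform.fourier_fourierInv_eq]
  have hint : Integrable (fun ξ => Complex.exp (Complex.I * t * ‖ξ‖) * 𝓕 (⇑f) ξ) := by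
    rw [← SchwartzMap.fourier_coe]
    refine (𝓕 f).integrable.bdd_mul (c := 1)
      (Continuous.aestronglyMeasurable (by fun_prop)) (.of_forall fun ξ => ?_)
    rw [show Complex.I * t * ‖ξ‖ = ((t * ‖ξ‖ : ℝ) : ℂ) * Complex.I by push_cast; ring,
      Complex.norm_exp_ofReal_mul_I]
  funext x
  rw [← hF, fourierInv_mul_fourier_eq_integral hint (hφ ▸ (𝓕⁻ Ψ : 𝓢(EuclideanSpace ℝ (Fin d), ℂ)).integrable), conv,
    ← integral_sub_left_eq_self _ volume x]
  simp only [_root_.sub_sub_cancel]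
  refine integral_congr_ae (.of_forall fun y => ?_)
  simp only [halfWave]
  ring

theorem exists_schwartz_conv_lpPiece {j : ℤ} {Ψ : 𝓢(EuclideanSpace ℝ (Fin d), ℂ)}
    (hΨ : ⇑Ψ = fun ξ => ψ ((2 : ℝ) ^ (-j) • ξ)) (f : 𝓢(EuclideanSpace ℝ (Fin d), ℂ)) :
    ∃ g : 𝓢(EuclideanSpace ℝ (Fin d), ℂ), ⇑g = conv d f (lpPiece d ψ j) ∧
      𝓕 (⇑g) = fun ξ => Ψ ξ * 𝓕 (⇑f) ξ := by
  let P : 𝓢(EuclideanSpace ℝ (Fin d), ℂ) := SchwartzMap.smulLeftCLM ℂ Ψ (𝓕 f)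
  have hP : ⇑P = fun ξ => Ψ ξ * 𝓕 (⇑f) ξ := by
    funext ξ
    simp only [P]
    rw [SchwartzMap.smulLeftCLM_apply_apply Ψ.hasTemperateGrowth, SchwartzMap.fourier_coe,
      smul_eq_mul]
  refine ⟨𝓕⁻ P, ?_, ?_⟩
  · rw [SchwartzMap.fourierInv_coe, hP]
    funext x
    rw [fourierInv_mul_fourier_eq_integral Ψ.integrable f.integrable, conv, lpPiece, ← hΨ]
  · rw [← SchwartzMap.fourier_coe, FourierTransform.fourier_fourierInv_eq, hP]

/-- The frequency-localised dispersive estimate. -/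
theorem exists_norm_conv_halfWave_lpPiece_le (hd : 1 ≤ d)
    (hψ_smooth : ContDiff ℝ (⊤ : ℕ∞) ψ)
    (hψ_supp : tsupport ψ ⊆ {ξ : EuclideanSpace ℝ (Fin d) | 1 / 2 ≤ ‖ξ‖ ∧ ‖ξ‖ ≤ 2}) :
    ∃ C : ℝ, 0 < C ∧ ∀ (j : ℤ) (t : ℝ), t ≠ 0 → ∀ f : 𝓢(EuclideanSpace ℝ (Fin d), ℂ),
      Integrable (conv d f (lpPiece d ψ j)) ∧ ∀ x,
      ‖conv d (halfWave d t f) (lpPiece d ψ j) x‖ ≤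
        C * |t| ^ (-(((d : ℝ) - 1) / 2)) * (2 : ℝ) ^ (((d : ℝ) + 1) / 2 * j) *
          ∫ y, ‖conv d f (lpPiece d ψ j) y‖ := by
  obtain ⟨m, hm_smooth, hm_supp, hm⟩ :=
    exists_contDiff_eq_cexp_norm_on_annulus (V := EuclideanSpace ℝ (Fin d))
  have hψ_cpt : HasCompactSupport ψ :=
    HasCompactSupport.of_support_subset_isCompact (isCompact_closedBall 0 2) fun ξ hξ => by
      simpa using (hψ_supp (subset_tsupport _ hξ)).2
  set A : ℝ := Real.pi ^ (-(1 / 2) : ℝ) * (4 * Real.pi) ^ (d / 2 : ℝ) *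
    Real.Gamma ((d + 1) / 2) with hA
  have hApos : 0 < A := by
    have := Real.Gamma_pos_of_pos (show (0 : ℝ) < (d + 1) / 2 by positivity)
    positivity
  set L : ℝ := ∫ x, ‖𝓕⁻ m x‖ with hL
  have hL0 : 0 ≤ L := integral_nonneg fun _ => norm_nonneg _
  refine ⟨A * (L + 1), by positivity, fun j t ht f => ?_⟩
  set r : ℝ := (2 : ℝ) ^ (-j) with hr
  have hrpos : 0 < r := by positivity
  obtain ⟨Ψ, hΨ⟩ := exists_schwartz_eq_comp_smul hψ_smooth hψ_cpt hrpos.ne'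
  obtain ⟨S, hS⟩ := exists_schwartz_eq_comp_smul hm_smooth hm_supp hrpos.ne'
  obtain ⟨g, hg, hFg⟩ := exists_schwartz_conv_lpPiece hΨ f
  refine ⟨hg ▸ g.integrable, fun x => ?_⟩
  set s : ℂ := ⟨r, -t⟩ with hs
  have hsre : 0 < s.re := hrpos
  set M : 𝓢(EuclideanSpace ℝ (Fin d), ℂ) := 𝓕⁻ S with hM
  have hFM : 𝓕 (⇑M) = ⇑S := by
    rw [hM, ← SchwartzMap.fourier_coe, FourierTransform.fourier_fourierInv_eq]
  have hMint : ∫ y, ‖M y‖ = L := by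
    rw [hM, SchwartzMap.fourierInv_coe, hS, integral_norm_fourierInv_comp_smul m hrpos]
  have hker (z : EuclideanSpace ℝ (Fin d)) :
      ‖𝓕⁻ (fun v : EuclideanSpace ℝ (Fin d) => Complex.exp (-s * ‖v‖)) z‖ ≤
        A * ((2 : ℝ) ^ (((d : ℝ) + 1) / 2 * j) * |t| ^ (-(((d : ℝ) - 1) / 2))) := by
    refine (norm_fourierInv_cexp_neg_mul_norm_le hsre z).trans ?_
    rw [finrank_euclideanSpace_fin]
    have h1 : s.re ^ (-((d + 1) / 2 : ℝ)) = (2 : ℝ) ^ (((d : ℝ) + 1) / 2 * j) := by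
      change r ^ (-((d + 1) / 2 : ℝ)) = _
      rw [hr, ← Real.rpow_intCast, ← Real.rpow_mul two_pos.le]
      congr 1
      push_cast
      ring
    have h2 : ‖s‖ ^ (-(((d : ℝ) - 1) / 2)) ≤ |t| ^ (-(((d : ℝ) - 1) / 2)) := by
      refine Real.rpow_le_rpow_of_nonpos (abs_pos.2 ht) ?_ ?_
      · simpa [hs] using Complex.abs_im_le_norm s
      · have : (1 : ℝ) ≤ d := by exact_mod_cast hd
        linarith
    rw [h1]
    gcongr
  have hE : Integrable (fun v : EuclideanSpace ℝ (Fin d) => Complex.exp (-s * ‖v‖)) :=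
    integrable_cexp_neg_mul_norm hsre
  have hES : Integrable (fun v : EuclideanSpace ℝ (Fin d) =>
      Complex.exp (-s * ‖v‖) * 𝓕 (⇑M) v) := by
    rw [hFM]
    refine S.integrable.bdd_mul (c := 1) hE.1 (.of_forall fun v => ?_)
    rw [Complex.norm_exp, Real.exp_le_one_iff, Complex.re_mul_ofReal, Complex.neg_re]
    exact mul_nonpos_of_nonpos_of_nonneg (by linarith) (norm_nonneg _)
  have hsymb : (fun ξ => Complex.exp (Complex.I * t * ‖ξ‖) * 𝓕 (⇑f) ξ * Ψ ξ) =
      fun ξ => (Complex.exp (-s * ‖ξ‖) * 𝓕 (⇑M) ξ) * 𝓕 (⇑g) ξ := by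
    funext ξ
    rw [hFM, hFg]
    simp only [hS, hΨ]
    by_cases h0 : ψ (r • ξ) = 0
    · simp [h0]
    · obtain ⟨h1, h2⟩ := hψ_supp (subset_tsupport _ h0)
      have hexp : Complex.exp (Complex.I * t * ‖ξ‖) =
          Complex.exp (-s * ‖ξ‖) * Complex.exp ‖r • ξ‖ := by
        rw [← Complex.exp_add, norm_smul, Real.norm_of_nonneg hrpos.le]
        congr 1
        have : s = r - t * Complex.I := by
          apply Complex.ext <;> simp [hs]
        rw [this]
        push_cast
        ring
      rw [hm _ h1 h2, hexp]
      ring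
  rw [conv_halfWave_lpPiece_eq hΨ, hsymb, ← hg]
  refine (norm_fourierInv_mul_fourier_le hES g.integrable
    (norm_fourierInv_mul_fourier_le hE M.integrable hker) x).trans ?_
  rw [hMint]
  have hg0 : 0 ≤ ∫ y, ‖g y‖ := integral_nonneg fun _ => norm_nonneg _
  refine mul_le_mul_of_nonneg_right ?_ hg0
  calc _ = A * L * |t| ^ (-(((d : ℝ) - 1) / 2)) * (2 : ℝ) ^ (((d : ℝ) + 1) / 2 * j) := by ring
    _ ≤ _ := by
      gcongr
      linarith

end LittlewoodPaley

/-- **Besov-space dispersive estimate for the half-wave propagator.**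
Let `d ≥ 2` and `ρ = (d+1)/4`. Fix `φ` with `φ̂ = ψ` smooth, supported in the annulus
`{ξ : 1/2 ≤ ‖ξ‖ ≤ 2}`, and satisfying `Σ_{j∈ℤ} ψ(2^{−j}ξ) = 1` for `ξ ≠ 0`. Then there is a
constant `C > 0` such that for all `t ≠ 0` and all Schwartz functions `f` on `ℝ^d`,
`‖e^{it√(−Δ)}f‖_{Ḃ^{−ρ}_{∞,2}} ≤ C |t|^{−(d−1)/2} ‖f‖_{Ḃ^{ρ}_{1,2}}`. -/
theorem halfWave_besov_dispersive_estimate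
    (d : ℕ) (hd : 2 ≤ d)
    (ψ : EuclideanSpace ℝ (Fin d) → ℂ)
    (hψ_smooth : ContDiff ℝ (⊤ : ℕ∞) ψ)
    (hψ_supp : tsupport ψ ⊆ {ξ : EuclideanSpace ℝ (Fin d) | 1 / 2 ≤ ‖ξ‖ ∧ ‖ξ‖ ≤ 2})
    (hψ_sum : ∀ ξ : EuclideanSpace ℝ (Fin d), ξ ≠ 0 →
      HasSum (fun j : ℤ => ψ ((2 : ℝ) ^ (-j) • ξ)) 1) :
    ∃ C : ℝ, 0 < C ∧
      ∀ t : ℝ, t ≠ 0 → ∀ f : 𝓢(EuclideanSpace ℝ (Fin d), ℂ),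
        besovNorm d ψ (-(((d : ℝ) + 1) / 4)) ⊤ (halfWave d t ⇑f)
          ≤ ENNReal.ofReal (C * |t| ^ (-(((d : ℝ) - 1) / 2)))
              * besovNorm d ψ (((d : ℝ) + 1) / 4) 1 ⇑f := by
  obtain ⟨C, hC, h⟩ := exists_norm_conv_halfWave_lpPiece_le (by omega) hψ_smooth hψ_supp
  refine ⟨C, hC, fun t ht f => ?_⟩
  set ρ : ℝ := ((d : ℝ) + 1) / 4 with hρ
  set K : ℝ≥0∞ := ENNReal.ofReal (C * |t| ^ (-(((d : ℝ) - 1) / 2))) with hK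
  have hterm (j : ℤ) : (2 : ℝ≥0∞) ^ (-ρ * (j : ℝ)) *
        eLpNorm (conv d (halfWave d t f) (lpPiece d ψ j)) ⊤ volume ≤
      K * ((2 : ℝ≥0∞) ^ (ρ * (j : ℝ)) * eLpNorm (conv d f (lpPiece d ψ j)) 1 volume) := by
    obtain ⟨hint, hle⟩ := h j t ht f
    have hA : eLpNorm (conv d (halfWave d t f) (lpPiece d ψ j)) ⊤ volume ≤
        K * (2 : ℝ≥0∞) ^ (2 * ρ * (j : ℝ)) * eLpNorm (conv d f (lpPiece d ψ j)) 1 volume := by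
      rw [eLpNorm_exponent_top]
      refine (eLpNormEssSup_le_of_ae_bound (.of_forall hle)).trans_eq ?_
      rw [ENNReal.ofReal_mul (by positivity), ENNReal.ofReal_mul (by positivity),
        ofReal_integral_norm_eq_lintegral_enorm hint, eLpNorm_one_eq_lintegral_enorm,
        ← ENNReal.ofReal_rpow_of_pos two_pos, ENNReal.ofReal_ofNat,
        show ((d : ℝ) + 1) / 2 = 2 * ρ by rw [hρ]; ring]
    refine (mul_le_mul_right hA _).trans_eq ?_
    rw [show ρ * (j : ℝ) = -ρ * j + 2 * ρ * j by ring,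
      ENNReal.rpow_add _ _ two_ne_zero ENNReal.ofNat_ne_top]
    ring
  calc besovNorm d ψ (-ρ) ⊤ (halfWave d t f)
      ≤ (∑' j : ℤ, (K * ((2 : ℝ≥0∞) ^ (ρ * (j : ℝ)) *
          eLpNorm (conv d f (lpPiece d ψ j)) 1 volume)) ^ (2 : ℝ)) ^ (1 / (2 : ℝ)) := by
        exact ENNReal.rpow_le_rpow (ENNReal.tsum_le_tsum fun j =>
          ENNReal.rpow_le_rpow (hterm j) two_pos.le) (by norm_num)
    _ = K * besovNorm d ψ ρ 1 f := by
        simp_rw [besovNorm, ENNReal.mul_rpow_of_nonneg K _ two_pos.le]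
        rw [ENNReal.tsum_mul_left, ENNReal.mul_rpow_of_nonneg _ _ (by norm_num),
          ← ENNReal.rpow_mul]
        norm_num
end
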